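/- (Generalized Hensel's Lemma.) Let n ≥ 1, let f₁, …, f_n ∈ K[x₁, …, x_n] be multivariate polynomials, let c₁, …, c_n ∈ K with v(c_k) ≠ 0 for all k, and let α₁, …, α_n ∈ Γ₀ with α_i ≠ 0. Assume: (1) each f_i is a γ̄-polynomial with residue value α_i, i.e. for every monomial of f_i with coefficient a and exponent vector (d₁, …, d_n) one has v(a) · ∏_k v(c_k)^{d_k} = α_i; (2) (c₁, …, c_n) represents a common residue root: for every a = (a₁, …, a_n) ∈ Kⁿ with v(a_k − c_k) < v(c_k) for all k, one has v(f_i(a)) < α_i for all i; (3) (simplicity) there exists a₀ ∈ Kⁿ with v(a₀ₖ − c_k) < v(c_k) for all k such that v(det((∂f_i/∂x_j)(a₀))_{i,j}) · ∏_k v(c_k) = ∏_i α_i, where ∂f_i/∂x_j denotes the formal partial derivative. Then there exists a unique a = (a₁, …, a_n) ∈ Kⁿ with v(a_k − c_k) < v(c_k) for all k and f_i(a) = 0 for all i. -/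

import Mathlib

universe u w

open MvPolynomial in
/-- A square polynomial system becomes étale after inverting its Jacobian determinant. -/
theorem exists_etale_of_jacobian {R : Type u} {ι : Type w} [CommRing R] [Fintype ι]
    [DecidableEq ι] (g : ι → MvPolynomial ι R) :
    ∃ (B : Type (max u w)) (_ : CommRing B) (_ : Algebra R B) (x : ι → B), Algebra.Etale R B ∧
      (∀ i, aeval x (g i) = 0) ∧
      ∀ (T : Type u) [CommRing T] [Algebra R T],
      (∀ φ ψ : B →ₐ[R] T, (∀ k, φ (x k) = ψ (x k)) → φ = ψ) ∧
      ∀ (a : ι → T), (∀ i, aeval a (g i) = 0) →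
        IsUnit (aeval a (Matrix.of fun i j => pderiv j (g i)).det) →
        ∃ φ : B →ₐ[R] T, ∀ k, φ (x k) = a k := by
  let A := MvPolynomial ι R ⧸ Ideal.span (Set.range g)
  let P : Algebra.PreSubmersivePresentation R A ι ι :=
    .naive id Function.injective_id
  let B := Localization.Away P.jacobian
  let Q := Algebra.PreSubmersivePresentation.localizationAway (R := A) B P.jacobian
  have hu : IsUnit (algebraMap A B P.jacobian) := IsLocalization.Away.algebraMap_isUnit _
  let S : Algebra.SubmersivePresentation R B (Unit ⊕ ι) (Unit ⊕ ι) :=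
    { Q.comp P with
      jacobian_isUnit := by
        rw [Algebra.PreSubmersivePresentation.comp_jacobian_eq_jacobian_smul_jacobian,
          Algebra.smul_def, Algebra.PreSubmersivePresentation.localizationAway_jacobian]
        exact hu.mul hu }
  have : Algebra.IsStandardSmoothOfRelativeDimension 0 R B :=
    S.isStandardSmoothOfRelativeDimension (by simp [Algebra.Presentation.dimension])
  refine ⟨B, inferInstance, inferInstance,
    fun k => algebraMap A B (Ideal.Quotient.mk _ (X k)), inferInstance, ?_, ?_⟩
  · intro i
    have : aeval (fun k => algebraMap A B (Ideal.Quotient.mk _ (X k))) (g i) =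
        algebraMap A B (Ideal.Quotient.mk _ (g i)) := by
      refine DFunLike.congr_fun (?_ : _ = (IsScalarTower.toAlgHom R A B).comp
        (Ideal.Quotient.mkₐ R (Ideal.span (Set.range g)))) (g i)
      ext k
      simp only [aeval_X]
      rfl
    rw [this, Ideal.Quotient.eq_zero_iff_mem.mpr (Ideal.subset_span (Set.mem_range_self i)),
      map_zero]
  intro T _ _
  refine ⟨fun φ ψ h => ?_, fun a ha hJ => ?_⟩
  · refine IsLocalization.algHom_ext (Submonoid.powers P.jacobian) ?_
    exact Ideal.Quotient.algHom_ext _ (MvPolynomial.algHom_ext h)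
  let φ : A →ₐ[R] T := Ideal.Quotient.liftₐ _ (aeval a) (by
    intro p hp
    have : Ideal.span (Set.range g) ≤ RingHom.ker (aeval a : _ →ₐ[R] T) := by
      rw [Ideal.span_le]
      rintro _ ⟨i, rfl⟩
      exact ha i
    exact this hp)
  have hφ : ∀ p, φ (Ideal.Quotient.mk _ p) = aeval a p := fun p => rfl
  have hφJ : IsUnit (φ P.jacobian) := by
    have : P.jacobian = Ideal.Quotient.mk _ (Matrix.of fun i j => pderiv j (g i)).det := by
      rw [P.jacobian_eq_jacobiMatrix_det, ← Matrix.det_transpose]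
      congr 2
      ext1 i j
      exact Algebra.PreSubmersivePresentation.jacobiMatrix_apply _ _ _
    rw [this, hφ]
    exact hJ
  refine ⟨IsLocalization.liftAlgHom (M := Submonoid.powers P.jacobian) (f := φ) ?_, ?_⟩
  · rintro ⟨_, m, rfl⟩
    simpa using hφJ.pow m
  · intro k
    simp [hφ]

open IsLocalRing in
/-- Valuation rings of algebraically closed fields are Henselian: points of étale algebras over the
residue field lift. -/
theorem ValuationSubring.exists_lift_of_etale {K : Type*} [Field K] [IsAlgClosed K]
    (V : ValuationSubring K) {B : Type*} [CommRing B] [Algebra V B] [Algebra.Etale V B]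
    (φ : B →ₐ[V] ResidueField V) :
    ∃ ψ : B →ₐ[V] V, ∀ b, residue V (ψ b) = φ b := by
  let q := RingHom.ker φ
  have : q.IsPrime := RingHom.ker_isPrime _
  have : q.LiesOver (q.under V) := ⟨rfl⟩
  obtain ⟨P, hPq, hP, hP0⟩ := Ideal.exists_ideal_le_liesOver_of_le q (bot_le : ⊥ ≤ q.under V)
  let D := B ⧸ P
  let L := FractionRing D
  have hinj : Function.Injective (algebraMap V D) := by
    rw [injective_iff_map_eq_zero]
    intro a ha
    rw [IsScalarTower.algebraMap_apply V B D] at ha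
    have : a ∈ P.under V := Ideal.mem_comap.mpr (Ideal.Quotient.eq_zero_iff_mem.mp ha)
    rw [← hP0.over] at this
    simpa using this
  have hinjL : Function.Injective (algebraMap V L) := by
    rw [IsScalarTower.algebraMap_eq V D L]
    exact (IsFractionRing.injective D L).comp hinj
  let : Algebra K L := (IsFractionRing.lift (K := K) hinjL).toAlgebra
  have : IsScalarTower V K L :=
    .of_algebraMap_eq fun x => (IsFractionRing.lift_algebraMap hinjL x).symm
  have : Algebra.FormallyUnramified B D := .of_surjective (Algebra.ofId B D)
    Ideal.Quotient.mk_surjective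
  have : Algebra.FormallyUnramified V D := .comp V B D
  have : Algebra.FormallyUnramified D L := .of_isLocalization (nonZeroDivisors D)
  have : Algebra.FormallyUnramified V L := .comp V D L
  have : Algebra.FormallyUnramified K L := .of_restrictScalars V K L
  have : Algebra.EssFiniteType D L := .of_isLocalization L (nonZeroDivisors D)
  have : Algebra.EssFiniteType V L := .comp V D L
  have : Algebra.EssFiniteType K L := .of_comp V K L
  have : Algebra.IsSeparable K L := Algebra.FormallyUnramified.isSeparable K L
  have hbij : Function.Bijective (algebraMap K L) := IsAlgClosed.algebraMap_bijective_of_isIntegral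
  let e : K ≃ₐ[K] L := AlgEquiv.ofBijective (Algebra.ofId K L) hbij
  let θ : B →ₐ[V] K := (e.symm.toAlgHom.restrictScalars V).comp (IsScalarTower.toAlgHom V B L)
  have hθ : ∀ b, θ b = 0 → φ b = 0 := by
    intro b hb
    have h1 : algebraMap D L (algebraMap B D b) = 0 := by
      have : e.symm (algebraMap B L b) = 0 := hb
      rw [map_eq_zero_iff _ e.symm.injective] at this
      rwa [← IsScalarTower.algebraMap_apply B D L]
    rw [map_eq_zero_iff _ (IsFractionRing.injective D L)] at h1
    exact hPq (Ideal.Quotient.eq_zero_iff_mem.mp h1)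
  have hV : ∀ b, θ b ∈ V := by
    intro b
    by_contra hb
    have hinv : (θ b)⁻¹ ∈ V := (V.mem_or_inv_mem _).resolve_left hb
    have h0 : θ b ≠ 0 := fun h => hb (h ▸ V.zero_mem)
    have hm : residue V ⟨_, hinv⟩ = 0 := by
      rw [residue_eq_zero_iff, mem_maximalIdeal, _root_.mem_nonunits_iff]
      intro hu
      obtain ⟨w, hw⟩ := hu.exists_right_inv
      have : (θ b)⁻¹ * w = 1 := congrArg Subtype.val hw
      rw [inv_mul_eq_one₀ h0] at this
      exact hb (this ▸ w.2)
    have := hθ (algebraMap V B ⟨_, hinv⟩ * b - 1) (by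
      rw [map_sub, map_mul, AlgHom.commutes, map_one, sub_eq_zero]
      exact inv_mul_cancel₀ h0)
    rw [map_sub, map_mul, AlgHom.commutes, map_one, ResidueField.algebraMap_eq, hm] at this
    simp at this
  let ψ : B →ₐ[V] V :=
    { toRingHom := θ.toRingHom.codRestrict V.toSubring hV
      commutes' := fun r => Subtype.ext (θ.commutes r) }
  refine ⟨ψ, fun b => ?_⟩
  have := hθ (b - algebraMap V B (ψ b)) (by
    rw [map_sub, AlgHom.commutes, sub_eq_zero]
    rfl)
  rw [map_sub, AlgHom.commutes, ResidueField.algebraMap_eq, sub_eq_zero] at this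
  exact this.symm

open MvPolynomial IsLocalRing in
theorem residue_eval_eq {R ι : Type*} [CommRing R] [IsLocalRing R] {a b : ι → R}
    (hab : ∀ k, residue R (a k) = residue R (b k)) (p : MvPolynomial ι R) :
    residue R (eval a p) = residue R (eval b p) := by
  simp only [eval, coe_eval₂Hom, hom_eval₂, hab]

open MvPolynomial IsLocalRing in
/-- A square polynomial system over a local ring has at most one zero in each residue class
where the Jacobian is invertible. -/
theorem eq_of_residue_eq_of_isUnit_jacobian {R ι : Type*} [CommRing R] [IsLocalRing R] [Fintype ι]
    [DecidableEq ι]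
    (g : ι → MvPolynomial ι R) {a b : ι → R} (hab : ∀ k, residue R (a k) = residue R (b k))
    (ha : ∀ i, eval a (g i) = 0) (hb : ∀ i, eval b (g i) = 0)
    (hJ : IsUnit (eval b (Matrix.of fun i j => pderiv j (g i)).det)) : a = b := by
  obtain ⟨B, _, _, x, _, -, hB⟩ := exists_etale_of_jacobian g
  have hJa : IsUnit (eval a (Matrix.of fun i j => pderiv j (g i)).det) := by
    rw [← residue_ne_zero_iff_isUnit] at hJ ⊢
    rwa [residue_eval_eq hab]
  obtain ⟨φ, hφ⟩ := (hB R).2 a ha hJa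
  obtain ⟨ψ, hψ⟩ := (hB R).2 b hb hJ
  let I : Ideal R := Ideal.span (Set.range fun k => a k - b k)
  have hI : I = ⊥ := by
    refine Submodule.eq_bot_of_le_smul_of_le_jacobson_bot I I
      (Submodule.fg_span (Set.finite_range _)) ?_ ?_
    · rw [smul_eq_mul, ← sq]
      have hmk : (Ideal.Quotient.mkₐ R I).comp φ = (Ideal.Quotient.mkₐ R I).comp ψ := by
        refine (hB (R ⧸ I)).1 _ _ fun k => Ideal.Quotient.eq.mpr ?_
        change φ (x k) - ψ (x k) ∈ I
        rw [hφ, hψ]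
        exact Ideal.subset_span ⟨k, rfl⟩
      have hsq : (Ideal.Quotient.mkₐ R (I ^ 2)).comp φ = (Ideal.Quotient.mkₐ R (I ^ 2)).comp ψ := by
        refine Algebra.FormallyUnramified.ext (I.map (Ideal.Quotient.mk (I ^ 2)))
          ⟨2, by rw [← Ideal.map_pow, Ideal.map_quotient_self]; rfl⟩ fun y => ?_
        rw [Ideal.Quotient.eq]
        have : φ y - ψ y ∈ I := Ideal.Quotient.eq.mp (DFunLike.congr_fun hmk y)
        exact map_sub (Ideal.Quotient.mk (I ^ 2)) _ _ ▸ Ideal.mem_map_of_mem _ this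
      rw [Ideal.span_le]
      rintro _ ⟨k, rfl⟩
      have : φ (x k) - ψ (x k) ∈ I ^ 2 := Ideal.Quotient.eq.mp (DFunLike.congr_fun hsq (x k))
      rwa [hφ, hψ] at this
    · rw [jacobson_eq_maximalIdeal _ bot_ne_top, Ideal.span_le]
      rintro _ ⟨k, rfl⟩
      rw [SetLike.mem_coe, ← residue_eq_zero_iff, map_sub, hab, sub_self]
  ext k
  have : a k - b k ∈ I := Ideal.subset_span ⟨k, rfl⟩
  rwa [hI, Ideal.mem_bot, sub_eq_zero] at this

open MvPolynomial IsLocalRing in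
/-- Multivariate Hensel's lemma over a valuation ring of an algebraically closed field. -/
theorem ValuationSubring.existsUnique_zero_of_isUnit_jacobian {K : Type*} [Field K] [IsAlgClosed K]
    (V : ValuationSubring K) {ι : Type*} [Fintype ι] [DecidableEq ι]
    (g : ι → MvPolynomial ι V) (b : ι → V) (hb : ∀ i, residue V (eval b (g i)) = 0)
    (hJ : IsUnit (eval b (Matrix.of fun i j => pderiv j (g i)).det)) :
    ∃! a : ι → V, (∀ k, residue V (a k) = residue V (b k)) ∧ ∀ i, eval a (g i) = 0 := by
  obtain ⟨B, _, _, x, _, hx, hB⟩ := exists_etale_of_jacobian g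
  have hres : ∀ p : MvPolynomial ι V, aeval (fun k => residue V (b k)) p = residue V (eval b p) := by
    intro p
    rw [← coe_aeval_eq_eval]
    exact (aeval_algebraMap_apply (ResidueField V) b p)
  obtain ⟨φ, hφ⟩ := (hB (ResidueField V)).2 (fun k => residue V (b k))
    (fun i => by rw [hres, hb]) (by rw [hres]; exact hJ.map _)
  obtain ⟨ψ, hψ⟩ := V.exists_lift_of_etale φ
  have hψb : ∀ k, residue V (ψ (x k)) = residue V (b k) := fun k => by rw [hψ, hφ]
  have hψ0 : ∀ i, eval (fun k => ψ (x k)) (g i) = 0 := by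
    intro i
    have : ψ (aeval x (g i)) = aeval (fun k => ψ (x k)) (g i) := by
      rw [← AlgHom.comp_apply, comp_aeval]
    rw [← coe_aeval_eq_eval, RingHom.coe_coe, ← this, hx, map_zero]
  refine ⟨fun k => ψ (x k), ⟨hψb, hψ0⟩, ?_⟩
  rintro a ⟨hab, ha⟩
  refine eq_of_residue_eq_of_isUnit_jacobian g (fun k => (hab k).trans (hψb k).symm) ha hψ0 ?_
  rw [← residue_ne_zero_iff_isUnit] at hJ ⊢
  rwa [residue_eval_eq hψb]

section Scaling

open MvPolynomial

variable {R σ : Type*} [CommSemiring R] (c : σ → R)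

theorem coeff_bind₁_C_mul_X (p : MvPolynomial σ R) (d : σ →₀ ℕ) :
    coeff d (bind₁ (fun k => C (c k) * X k) p) = coeff d p * d.prod fun k m => c k ^ m := by
  classical
  induction p using MvPolynomial.induction_on' with
  | add p q hp hq => simp [hp, hq, add_mul]
  | monomial e r =>
    have : bind₁ (fun k => C (c k) * X k) (monomial e r) =
        monomial e (r * e.prod fun k m => c k ^ m) := by
      rw [bind₁_monomial, monomial_eq, C_mul, mul_assoc, map_finsuppProd C]
      simp only [Finsupp.prod, ← Finset.prod_mul_distrib, mul_pow, C_pow]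
    rw [this, coeff_monomial, coeff_monomial]
    split_ifs with h
    · rw [h]
    · rw [zero_mul]

theorem pderiv_bind₁_C_mul_X (p : MvPolynomial σ R) (j : σ) :
    pderiv j (bind₁ (fun k => C (c k) * X k) p) =
      C (c j) * bind₁ (fun k => C (c k) * X k) (pderiv j p) := by
  classical
  induction p using MvPolynomial.induction_on with
  | C a => simp
  | add p q hp hq => simp [hp, hq, mul_add]
  | mul_X p i hp =>
    by_cases h : i = j
    · subst h
      simp [hp]
      ring
    · simp [hp, pderiv_X_of_ne h]
      ring

theorem eval_bind₁_C_mul_X (p : MvPolynomial σ R) (a : σ → R) :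
    eval a (bind₁ (fun k => C (c k) * X k) p) = eval (fun k => c k * a k) p := by
  induction p using MvPolynomial.induction_on with
  | C a => simp
  | add p q hp hq => simp [hp, hq]
  | mul_X p i hp => simp [hp]

end Scaling

theorem Valuation.residue_eq_residue_iff {K Γ₀ : Type*} [Field K]
    [LinearOrderedCommGroupWithZero Γ₀] (v : Valuation K Γ₀) (x y : v.valuationSubring) :
    IsLocalRing.residue _ x = IsLocalRing.residue _ y ↔ v ((x : K) - y) < 1 := by
  have hv : v.Integers v.valuationSubring := Valuation.integer.integers v
  rw [← sub_eq_zero, ← RingHom.map_sub, IsLocalRing.residue_eq_zero_iff, IsLocalRing.mem_maximalIdeal,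
    mem_nonunits_iff, hv.isUnit_iff_valuation_eq_one]
  exact (hv.map_le_one (x - y)).lt_iff_ne.symm


/-- Generalized Hensel's Lemma: if `f₁, …, f_n` are `γ̄`-polynomials with residue
values `α₁, …, α_n`, and the rv-polyball of `c` is a simple common residue root,
then there is a unique common root of `f₁, …, f_n` in the rv-polyball of `c`. -/
theorem generalized_hensel
    {K : Type*} [Field K] [IsAlgClosed K]
    {Γ₀ : Type*} [LinearOrderedCommGroupWithZero Γ₀]
    (v : Valuation K Γ₀) {n : ℕ} (hn : 1 ≤ n)
    (f : Fin n → MvPolynomial (Fin n) K) (c : Fin n → K) (α : Fin n → Γ₀)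
    (hc : ∀ k, v (c k) ≠ 0) (hα : ∀ i, α i ≠ 0)
    (h1 : ∀ i, ∀ d ∈ (f i).support,
      v (MvPolynomial.coeff d (f i)) * ∏ k, v (c k) ^ (d k) = α i)
    (h2 : ∀ a : Fin n → K, (∀ k, v (a k - c k) < v (c k)) →
      ∀ i, v (MvPolynomial.eval a (f i)) < α i)
    (h3 : ∃ a₀ : Fin n → K, (∀ k, v (a₀ k - c k) < v (c k)) ∧
      v (Matrix.det (Matrix.of fun i j =>
          MvPolynomial.eval a₀ (MvPolynomial.pderiv j (f i)))) * ∏ k, v (c k)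
        = ∏ i, α i) :
    ∃! a : Fin n → K,
      (∀ k, v (a k - c k) < v (c k)) ∧ ∀ i, MvPolynomial.eval a (f i) = 0 := by
  obtain ⟨a₀, ha₀, hdet⟩ := h3
  let V := v.valuationSubring
  have hv : v.Integers V := Valuation.integer.integers v
  have hc0 : ∀ k, c k ≠ 0 := fun k => (map_ne_zero v).mp (hc k)
  have hdet0 : ∏ i, α i ≠ 0 := Finset.prod_ne_zero_iff.mpr fun i _ => hα i
  have hβ : ∀ i, ∃ β : K, v β = α i := by
    intro i
    have hf : f i ≠ 0 := by
      intro hf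
      refine hdet0 ?_
      rw [← hdet, Matrix.det_eq_zero_of_row_eq_zero i (fun j => by simp [hf]), map_zero, zero_mul]
    obtain ⟨d, hd⟩ := MvPolynomial.support_nonempty.mpr hf
    exact ⟨_, (by simp [map_prod] : v (MvPolynomial.coeff d (f i) * ∏ k, c k ^ d k) = _).trans
      (h1 i d hd)⟩
  choose β hβ using hβ
  have hβ0 : ∀ i, β i ≠ 0 := fun i => (map_ne_zero v).mp (hβ i ▸ hα i)
  have hg : ∀ i, ∃ g : MvPolynomial (Fin n) V, MvPolynomial.map (algebraMap V K) g =
      MvPolynomial.C (β i)⁻¹ *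
        MvPolynomial.bind₁ (fun k => MvPolynomial.C (c k) * MvPolynomial.X k) (f i) := by
    intro i
    refine MvPolynomial.mem_range_map_iff_coeffs_subset.mpr fun x hx => ?_
    obtain ⟨d, hd, rfl⟩ := MvPolynomial.mem_coeffs_iff.mp hx
    rw [MvPolynomial.mem_support_iff] at hd
    rw [MvPolynomial.coeff_C_mul, coeff_bind₁_C_mul_X,
      Finsupp.prod_fintype _ _ (fun _ => pow_zero _)] at hd ⊢
    have hd' : d ∈ (f i).support := MvPolynomial.mem_support_iff.mpr fun h => hd (by simp [h])
    have hval : v ((β i)⁻¹ * (MvPolynomial.coeff d (f i) * ∏ k, c k ^ d k)) = 1 := by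
      rw [map_mul, map_mul, map_prod, map_inv₀, hβ]
      simp only [map_pow, h1 i d hd']
      exact inv_mul_cancel₀ (hα i)
    exact ⟨⟨_, hval.le⟩, rfl⟩
  choose g hg using hg
  have heval : ∀ (y : Fin n → V) p, algebraMap V K (MvPolynomial.eval y p) =
      MvPolynomial.eval (fun k => (y k : K)) (MvPolynomial.map (algebraMap V K) p) := by
    intro y p
    rw [MvPolynomial.eval_map]
    exact MvPolynomial.hom_eval₂ _ _ _ _
  have hgeval : ∀ (y : Fin n → V) i, (MvPolynomial.eval y (g i) : K) =
      (β i)⁻¹ * MvPolynomial.eval (fun k => c k * y k) (f i) := by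
    intro y i
    refine (heval y (g i)).trans ?_
    rw [hg, map_mul, MvPolynomial.eval_C, eval_bind₁_C_mul_X]
  have hzero : ∀ (y : Fin n → V) i, MvPolynomial.eval y (g i) = 0 ↔
      MvPolynomial.eval (fun k => c k * y k) (f i) = 0 := by
    intro y i
    rw [← ZeroMemClass.coe_eq_zero, hgeval, mul_eq_zero, or_iff_right (inv_ne_zero (hβ0 i))]
  have hres : ∀ (y : V) k, IsLocalRing.residue V y = 1 ↔ v (c k * y - c k) < v (c k) := by
    intro y k
    rw [← map_one (IsLocalRing.residue V), v.residue_eq_residue_iff, ← mul_sub_one, map_mul]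
    exact (mul_lt_iff_lt_one_right (zero_lt_iff.mpr (hc k))).symm
  have hscale : ∀ a : Fin n → K, (∀ k, v (a k - c k) < v (c k)) →
      ∃ y : Fin n → V, a = fun k => c k * y k := by
    intro a ha
    have hle : ∀ k, v (a k / c k) ≤ 1 := by
      intro k
      rw [map_div₀, v.map_eq_of_sub_lt (ha k), div_self (hc k)]
    exact ⟨fun k => ⟨_, hle k⟩, funext fun k => (mul_div_cancel₀ _ (hc0 k)).symm⟩
  obtain ⟨b, rfl⟩ := hscale a₀ ha₀
  have hb1 : ∀ k, IsLocalRing.residue V (b k) = 1 := fun k => (hres _ k).mpr (ha₀ k)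
  have hb : ∀ i, IsLocalRing.residue V (MvPolynomial.eval b (g i)) = 0 := by
    intro i
    rw [← map_zero (IsLocalRing.residue V), v.residue_eq_residue_iff, hgeval, ZeroMemClass.coe_zero,
      sub_zero, map_mul, map_inv₀, hβ]
    exact (inv_mul_lt_one₀ (zero_lt_iff.mpr (hα i))).mpr (h2 _ ha₀ i)
  have hJ : IsUnit (MvPolynomial.eval b
      (Matrix.of fun i j => MvPolynomial.pderiv j (g i)).det) := by
    rw [hv.isUnit_iff_valuation_eq_one]
    have hentry : ∀ i j, algebraMap V K (MvPolynomial.eval b (MvPolynomial.pderiv j (g i))) =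
        (β i)⁻¹ * (c j * MvPolynomial.eval (fun k => c k * b k)
          (MvPolynomial.pderiv j (f i))) := by
      intro i j
      rw [heval, ← MvPolynomial.pderiv_map, hg, MvPolynomial.pderiv_C_mul, pderiv_bind₁_C_mul_X,
        map_mul, map_mul, MvPolynomial.eval_C, MvPolynomial.eval_C, eval_bind₁_C_mul_X]
    rw [RingHom.map_det, RingHom.map_det]
    have hmat : (algebraMap V K).mapMatrix ((MvPolynomial.eval b).mapMatrix
        (Matrix.of fun i j => MvPolynomial.pderiv j (g i))) =
        Matrix.of fun i j => (β i)⁻¹ * (Matrix.of fun i j => c j * (Matrix.of fun i j =>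
          MvPolynomial.eval (fun k => c k * b k) (MvPolynomial.pderiv j (f i))) i j) i j :=
      Matrix.ext hentry
    rw [hmat, Matrix.det_mul_column, Matrix.det_mul_row, map_mul, map_mul, map_prod, map_prod,
      mul_comm (∏ k, v (c k)), hdet]
    simp only [map_inv₀, hβ, Finset.prod_inv_distrib]
    exact inv_mul_cancel₀ hdet0
  obtain ⟨y, ⟨hyb, hy0⟩, huniq⟩ := V.existsUnique_zero_of_isUnit_jacobian g b hb hJ
  refine ⟨fun k => c k * y k, ⟨fun k => (hres _ k).mp ((hyb k).trans (hb1 k)),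
    fun i => (hzero y i).mp (hy0 i)⟩, ?_⟩
  rintro a ⟨ha, ha0⟩
  obtain ⟨z, rfl⟩ := hscale a ha
  rw [huniq z ⟨fun k => ((hres _ k).mpr (ha k)).trans (hb1 k).symm,
    fun i => (hzero z i).mpr (ha0 i)⟩]
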